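/- Let q be the Chevalley-Eilenberg vector field q ξ^a = ρ^a{}_b ξ^b, q ρ^{ab} = ρ^a{}_c ρ^{cb} + λ ξ^a ξ^b and ω = 𝒱_{abc}(ξ) dξ^a ∧ dρ^{bc}. Then the contraction ι_q ω equals d𝓗 for 𝓗 = 𝒱_{ab}(ξ)(ρ^a{}_c ρ^{cb} + ((n−2)λ/n) ξ^a ξ^b). -/

import Mathlib

open scoped BigOperators

noncomputable def eps {n : ℕ} (g : Fin n → Fin n) : ℝ :=
  ∑ σ : Equiv.Perm (Fin n),
    if (σ : Fin n → Fin n) = g then ((Equiv.Perm.sign σ : ℤ) : ℝ) else 0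

def cat3 {n : ℕ} (a b c : Fin n) (f : Fin (n - 3) → Fin n) : Fin n → Fin n :=
  fun i =>
    if i.val = 0 then a
    else if i.val = 1 then b
    else if i.val = 2 then c
    else if h : i.val - 3 < n - 3 then f ⟨i.val - 3, h⟩ else a

def cat2 {n : ℕ} (a b : Fin n) (f : Fin (n - 2) → Fin n) : Fin n → Fin n :=
  fun i =>
    if i.val = 0 then a
    else if i.val = 1 then b
    else if h : i.val - 2 < n - 2 then f ⟨i.val - 2, h⟩ else a

noncomputable def Vthree {n : ℕ} {A : Type*} [Ring A] [Algebra ℝ A]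
    (ξ : Fin n → A) (a b c : Fin n) : A :=
  ((Nat.factorial (n - 3) : ℝ))⁻¹ •
    ∑ f : Fin (n - 3) → Fin n,
      eps (cat3 a b c f) • (List.ofFn fun j => ξ (f j)).prod

noncomputable def Vtwo {n : ℕ} {A : Type*} [Ring A] [Algebra ℝ A]
    (ξ : Fin n → A) (a b : Fin n) : A :=
  ((Nat.factorial (n - 2) : ℝ))⁻¹ •
    ∑ f : Fin (n - 2) → Fin n,
      eps (cat2 a b f) • (List.ofFn fun j => ξ (f j)).prod

theorem eps_comp {n : ℕ} (g : Fin n → Fin n) (τ : Equiv.Perm (Fin n)) :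
    eps (g ∘ τ) = ((Equiv.Perm.sign τ : ℤ) : ℝ) * eps g := by
  unfold eps
  rw [Finset.mul_sum]
  refine (Fintype.sum_equiv (Equiv.mulRight τ) _ _ ?_).symm
  intro σ
  by_cases h : (σ : Fin n → Fin n) = g
  · subst h
    simp [mul_comm]
  · have h' : ¬ ((σ * τ : Equiv.Perm (Fin n)) : Fin n → Fin n) = g ∘ τ := by
      intro h2
      apply h
      funext x
      have := congrFun h2 (τ.symm x)
      simpa using this
    rw [Equiv.coe_mulRight, if_neg h, if_neg h', mul_zero]

theorem eps_ne_zero {n : ℕ} {g : Fin n → Fin n} (h : eps g ≠ 0) : Function.Bijective g := by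
  unfold eps at h
  obtain ⟨σ, -, hσ⟩ := Finset.exists_ne_zero_of_sum_ne_zero h
  have : (σ : Fin n → Fin n) = g := by
    by_contra h2
    exact hσ (if_neg h2)
  rw [← this]
  exact σ.bijective

theorem eps_insert {m : ℕ} (i : Fin (m + 1)) (c : Fin (m + 1)) (h : Fin m → Fin (m + 1)) :
    eps (i.insertNth c h : Fin (m + 1) → Fin (m + 1))
      = (-1 : ℝ) ^ (i : ℕ) * eps (Fin.cons c h : Fin (m + 1) → Fin (m + 1)) := by
  rw [← Fin.cons_comp_cycleRange, eps_comp, Fin.sign_cycleRange]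
  simp

theorem cat3_eq {k : ℕ} (a b c : Fin (k + 3)) (f : Fin k → Fin (k + 3)) :
    cat3 (n := k + 3) a b c f
      = (Fin.cons a (Fin.cons b (Fin.cons c f : Fin (k + 1) → Fin (k + 3))
          : Fin (k + 2) → Fin (k + 3)) : Fin (k + 3) → Fin (k + 3)) := by
  funext i
  refine Fin.cases ?_ (fun i => ?_) i
  · simp [cat3]
  refine Fin.cases ?_ (fun i => ?_) i
  · simp [cat3]
  refine Fin.cases ?_ (fun i => ?_) i
  · rw [Fin.cons_succ, Fin.cons_succ, Fin.cons_zero]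
    rfl
  simp [cat3]

theorem cat2_eq {k : ℕ} (a b : Fin (k + 3)) (f : Fin (k + 1) → Fin (k + 3)) :
    cat2 (n := k + 3) a b f
      = (Fin.cons a (Fin.cons b f : Fin (k + 2) → Fin (k + 3)) : Fin (k + 3) → Fin (k + 3)) := by
  funext i
  refine Fin.cases ?_ (fun i => ?_) i
  · simp [cat2]
  refine Fin.cases ?_ (fun i => ?_) i
  · simp [cat2]
  rw [Fin.cons_succ, Fin.cons_succ]
  have hi : (i : ℕ) < k + 1 := i.isLt
  simp [cat2, hi]

theorem eps2_swap {k : ℕ} (a b : Fin (k + 3)) (f : Fin (k + 1) → Fin (k + 3)) :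
    eps (cat2 (n := k + 3) a b f) = - eps (cat2 (n := k + 3) b a f) := by
  rw [cat2_eq, cat2_eq]
  have := eps_insert (m := k + 2) (Fin.succ 0) b (Fin.cons a f : Fin (k + 2) → Fin (k + 3))
  rw [Fin.insertNth_succ_cons, Fin.insertNth_zero'] at this
  simpa using this

theorem eps3_swap {k : ℕ} (a b c : Fin (k + 3)) (f : Fin k → Fin (k + 3)) :
    eps (cat3 (n := k + 3) a b c f) = - eps (cat3 (n := k + 3) b a c f) := by
  rw [cat3_eq, cat3_eq]
  have := eps_insert (m := k + 2) (Fin.succ 0) b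
    (Fin.cons a (Fin.cons c f : Fin (k + 1) → Fin (k + 3)) : Fin (k + 2) → Fin (k + 3))
  rw [Fin.insertNth_succ_cons, Fin.insertNth_zero'] at this
  simpa using this

theorem eps3_cyc {k : ℕ} (a b c : Fin (k + 3)) (f : Fin k → Fin (k + 3)) :
    eps (cat3 (n := k + 3) a b c f) = eps (cat3 (n := k + 3) c a b f) := by
  rw [cat3_eq, cat3_eq]
  have := eps_insert (m := k + 2) (Fin.succ (Fin.succ 0)) c
    (Fin.cons a (Fin.cons b f : Fin (k + 1) → Fin (k + 3)) : Fin (k + 2) → Fin (k + 3))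
  rw [Fin.insertNth_succ_cons, Fin.insertNth_succ_cons, Fin.insertNth_zero'] at this
  rw [this]
  simp only [Fin.val_succ, Fin.val_zero]
  norm_num

theorem eps2_insert {k : ℕ} (a b c : Fin (k + 3)) (i : Fin (k + 1)) (f : Fin k → Fin (k + 3)) :
    eps (cat2 (n := k + 3) a b (i.insertNth c f : Fin (k + 1) → Fin (k + 3)))
      = (-1 : ℝ) ^ (i : ℕ) * eps (cat3 (n := k + 3) a b c f) := by
  rw [eps3_cyc, cat3_eq, cat2_eq]
  have := eps_insert (m := k + 2) (Fin.succ (Fin.succ i)) c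
    (Fin.cons a (Fin.cons b f : Fin (k + 1) → Fin (k + 3)) : Fin (k + 2) → Fin (k + 3))
  rw [Fin.insertNth_succ_cons, Fin.insertNth_succ_cons] at this
  rw [this]
  simp [pow_succ]

/-- expansion of the sum over index tuples along one removed index. -/
theorem sum_expand {k : ℕ} {A : Type*} [Ring A] [Algebra ℝ A] (a b : Fin (k + 3))
    (F : Fin (k + 3) → (Fin k → Fin (k + 3)) → A) :
    ∑ f : Fin (k + 1) → Fin (k + 3), eps (cat2 (n := k + 3) a b f) •
        ∑ i : Fin (k + 1), (-1 : ℝ) ^ (i : ℕ) • F (f i) (fun j => f (i.succAbove j))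
      = ((k : ℝ) + 1) • ∑ c, ∑ f : Fin k → Fin (k + 3),
          eps (cat3 (n := k + 3) a b c f) • F c f := by
  simp_rw [Finset.smul_sum (s := (Finset.univ : Finset (Fin (k + 1))))]
  rw [Finset.sum_comm]
  have : ∀ i : Fin (k + 1), ∑ f : Fin (k + 1) → Fin (k + 3),
      eps (cat2 (n := k + 3) a b f) •
        ((-1 : ℝ) ^ (i : ℕ) • F (f i) (fun j => f (i.succAbove j)))
      = ∑ c, ∑ f : Fin k → Fin (k + 3), eps (cat3 (n := k + 3) a b c f) • F c f := by
    intro i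
    rw [← Fintype.sum_prod_type']
    refine (Fintype.sum_equiv (Fin.insertNthEquiv (fun _ => Fin (k + 3)) i) _ _ ?_).symm
    rintro ⟨c, f⟩
    simp only [Fin.insertNthEquiv_apply, Fin.insertNth_apply_same,
      Fin.insertNth_apply_succAbove, smul_smul]
    congr 1
    rw [show (Fin.insertNthEquiv (fun _ => Fin (k + 3)) i) (c, f)
      = (i.insertNth c f : Fin (k + 1) → Fin (k + 3)) from rfl, eps2_insert, mul_right_comm, ← mul_pow]
    simp
  rw [Finset.sum_congr rfl (fun i _ => this i)]
  rw [Finset.sum_const, Finset.card_univ, Fintype.card_fin, ← Nat.cast_smul_eq_nsmul ℝ]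
  push_cast
  rfl

section prods

variable {N : ℕ} {A : Type*} [Ring A] [Algebra ℝ A] (ξ : Fin N → A)

theorem prod_anti (y : A) (hy : ∀ a, ξ a * y = - (y * ξ a)) : ∀ (m : ℕ) (f : Fin m → Fin N),
    (List.ofFn fun j => ξ (f j)).prod * y
      = (-1 : ℝ) ^ m • (y * (List.ofFn fun j => ξ (f j)).prod) := by
  intro m
  induction m with
  | zero => intro f; simp
  | succ m ih =>
    intro f
    rw [List.ofFn_succ, List.prod_cons, mul_assoc, ih (fun j => f j.succ), mul_smul_comm,
      ← mul_assoc, hy, pow_succ]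
    simp [mul_assoc]

theorem prod_pull (hξξ : ∀ a b, ξ a * ξ b = - (ξ b * ξ a)) :
    ∀ (m : ℕ) (f : Fin (m + 1) → Fin N) (i : Fin (m + 1)),
    (List.ofFn fun j => ξ (f j)).prod
      = (-1 : ℝ) ^ (i : ℕ) • (ξ (f i) * (List.ofFn fun j => ξ (f (i.succAbove j))).prod) := by
  intro m
  induction m with
  | zero => intro f i; fin_cases i; simp
  | succ m ih =>
    intro f i
    refine Fin.cases ?_ (fun i => ?_) i
    · simp [List.ofFn_succ]
    · rw [List.ofFn_succ, List.prod_cons, ih (fun j => f j.succ) i, mul_smul_comm,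
        ← mul_assoc, hξξ, List.ofFn_succ (n := m), List.prod_cons]
      simp [pow_succ, mul_assoc]

theorem prod_iota (ι : A →ₗ[ℝ] A) (hιLξ : ∀ a x, ι (ξ a * x) = ξ a * ι x) :
    ∀ (m : ℕ) (f : Fin m → Fin N) (x : A),
    ι ((List.ofFn fun j => ξ (f j)).prod * x) = (List.ofFn fun j => ξ (f j)).prod * ι x := by
  intro m
  induction m with
  | zero => intro f x; simp
  | succ m ih =>
    intro f x
    rw [List.ofFn_succ, List.prod_cons, mul_assoc, hιLξ, ih (fun j => f j.succ), mul_assoc]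

theorem prod_d (Dξ : Fin N → A) (hDξc : ∀ a x, Dξ a * x = x * Dξ a) (d : A →ₗ[ℝ] A)
    (hdLξ : ∀ a x, d (ξ a * x) = Dξ a * x - ξ a * d x) :
    ∀ (m : ℕ) (f : Fin (m + 1) → Fin N) (x : A),
    d ((List.ofFn fun j => ξ (f j)).prod * x)
      = (∑ i : Fin (m + 1), (-1 : ℝ) ^ (i : ℕ) •
          ((List.ofFn fun j => ξ (f (i.succAbove j))).prod * Dξ (f i))) * x
        + (-1 : ℝ) ^ (m + 1) • ((List.ofFn fun j => ξ (f j)).prod * d x) := by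
  intro m
  induction m with
  | zero => intro f x; simp [hdLξ, sub_eq_add_neg]
  | succ m ih =>
    intro f x
    rw [List.ofFn_succ, List.prod_cons, mul_assoc, hdLξ, ih (fun j => f j.succ),
      Fin.sum_univ_succ (n := m + 1)]
    simp only [List.ofFn_succ (n := m), List.prod_cons]
    simp only [Fin.succ_succAbove_zero, Fin.succ_succAbove_succ, Fin.val_succ, Fin.zero_succAbove,
      Fin.val_zero, pow_zero, one_smul, pow_succ, mul_add, add_mul, Finset.sum_mul, Finset.mul_sum,
      smul_mul_assoc, mul_smul_comm, mul_assoc, hDξc]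
    simp [sub_eq_add_neg, add_assoc]
    exact add_comm _ _

end prods

theorem zero_of_eq_neg {A : Type*} [Ring A] [Algebra ℝ A] {x : A} (h : x = -x) : x = 0 := by
  have h2 : (2 : ℝ) • x = 0 := by
    rw [two_smul]
    nth_rewrite 2 [h]
    exact add_neg_cancel x
  have h3 : (2 : ℝ)⁻¹ • ((2 : ℝ) • x) = x := by
    rw [smul_smul]; norm_num
  rw [← h3, h2, smul_zero]

section vs

variable {k : ℕ} {A : Type*} [Ring A] [Algebra ℝ A] (ξ : Fin (k + 3) → A)

theorem V3_def (a b c : Fin (k + 3)) : Vthree ξ a b c = ((Nat.factorial k : ℝ))⁻¹ •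
    ∑ f : Fin k → Fin (k + 3),
      eps (cat3 (n := k + 3) a b c f) • (List.ofFn fun j => ξ (f j)).prod := rfl

theorem V2_def (a b : Fin (k + 3)) : Vtwo ξ a b = ((Nat.factorial (k + 1) : ℝ))⁻¹ •
    ∑ f : Fin (k + 1) → Fin (k + 3),
      eps (cat2 (n := k + 3) a b f) • (List.ofFn fun j => ξ (f j)).prod := rfl

theorem V2_swap (a b : Fin (k + 3)) : Vtwo ξ a b = - Vtwo ξ b a := by
  simp only [V2_def, eps2_swap a b, neg_smul, Finset.sum_neg_distrib, smul_neg]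

theorem V3_swap (a b c : Fin (k + 3)) : Vthree ξ a b c = - Vthree ξ b a c := by
  simp only [V3_def, eps3_swap a b, neg_smul, Finset.sum_neg_distrib, smul_neg]

theorem V3_cyc (a b c : Fin (k + 3)) : Vthree ξ a b c = Vthree ξ c a b := by
  simp only [V3_def, eps3_cyc a b]

theorem V2_diag (a : Fin (k + 3)) : Vtwo ξ a a = 0 := zero_of_eq_neg (V2_swap ξ a a)

theorem V3_diag (a c : Fin (k + 3)) : Vthree ξ a a c = 0 := zero_of_eq_neg (V3_swap ξ a a c)

theorem V3_anti (y : A) (hy : ∀ a, ξ a * y = - (y * ξ a)) (a b c : Fin (k + 3)) :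
    Vthree ξ a b c * y = (-1 : ℝ) ^ k • (y * Vthree ξ a b c) := by
  simp only [V3_def, smul_mul_assoc, mul_smul_comm, Finset.sum_mul, Finset.mul_sum,
    prod_anti ξ y hy, Finset.smul_sum]
  refine Finset.sum_congr rfl fun f _ => ?_
  simp only [smul_smul]
  congr 1
  ring

theorem V3_iota (ι : A →ₗ[ℝ] A) (hιLξ : ∀ a x, ι (ξ a * x) = ξ a * ι x)
    (a b c : Fin (k + 3)) (x : A) : ι (Vthree ξ a b c * x) = Vthree ξ a b c * ι x := by
  simp only [V3_def, smul_mul_assoc, Finset.sum_mul, map_smul, map_sum, prod_iota ξ ι hιLξ]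

theorem fact_scale : ((Nat.factorial (k + 1) : ℝ))⁻¹ * ((k : ℝ) + 1)
    = ((Nat.factorial k : ℝ))⁻¹ := by
  have h1 : (Nat.factorial k : ℝ) ≠ 0 := by positivity
  have h2 : (k : ℝ) + 1 ≠ 0 := by positivity
  rw [Nat.factorial_succ]
  push_cast
  field_simp

theorem V2_d (Dξ : Fin (k + 3) → A) (hDξc : ∀ a x, Dξ a * x = x * Dξ a) (d : A →ₗ[ℝ] A)
    (hdLξ : ∀ a x, d (ξ a * x) = Dξ a * x - ξ a * d x) (a b : Fin (k + 3)) (x : A) :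
    d (Vtwo ξ a b * x) = (∑ c, Vthree ξ a b c * Dξ c) * x
      + (-1 : ℝ) ^ (k + 1) • (Vtwo ξ a b * d x) := by
  have h1 : ∑ c, Vthree ξ a b c * Dξ c = ((Nat.factorial (k + 1) : ℝ))⁻¹ •
      ∑ f : Fin (k + 1) → Fin (k + 3), eps (cat2 (n := k + 3) a b f) •
        ∑ i : Fin (k + 1), (-1 : ℝ) ^ (i : ℕ) •
          ((List.ofFn fun j => ξ (f (i.succAbove j))).prod * Dξ (f i)) := by
    have := sum_expand a b (fun c f => (List.ofFn fun j => ξ (f j)).prod * Dξ c)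
    rw [this, smul_smul, fact_scale]
    simp only [V3_def, smul_mul_assoc, Finset.sum_mul, Finset.smul_sum]
  rw [h1]
  simp only [V2_def, smul_mul_assoc, Finset.sum_mul _ _ x, map_smul, map_sum,
    prod_d ξ Dξ hDξc d hdLξ]
  simp only [smul_add, Finset.sum_add_distrib, Finset.sum_mul, smul_mul_assoc]
  congr 1
  simp only [Finset.smul_sum, smul_smul]
  refine Finset.sum_congr rfl fun f _ => ?_
  congr 1
  ring

theorem xi_same (hξξ : ∀ a b, ξ a * ξ b = - (ξ b * ξ a)) (a b c : Fin (k + 3))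
    (hca : c ≠ a) (hcb : c ≠ b) : ξ c * Vthree ξ a b c = Vtwo ξ a b := by
  have h := sum_expand a b
    (fun e f => if e = c then ξ c * (List.ofFn fun j => ξ (f j)).prod else 0)
  have h2 : ∀ f : Fin (k + 1) → Fin (k + 3),
      eps (cat2 (n := k + 3) a b f) • (List.ofFn fun j => ξ (f j)).prod =
      eps (cat2 (n := k + 3) a b f) • ∑ i : Fin (k + 1), (-1 : ℝ) ^ (i : ℕ) •
        (if f i = c then ξ c * (List.ofFn fun j => ξ (f (i.succAbove j))).prod else 0) := by
    intro f
    by_cases h0 : eps (cat2 (n := k + 3) a b f) = 0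
    · rw [h0, zero_smul, zero_smul]
    have hb := eps_ne_zero h0
    rw [cat2_eq] at hb
    obtain ⟨i, hi⟩ := hb.2 c
    revert hi
    refine Fin.cases ?_ (fun i => ?_) i
    · intro hi; exact absurd hi.symm hca
    refine Fin.cases ?_ (fun i => ?_) i
    · intro hi; exact absurd hi.symm hcb
    intro hi
    simp only [Fin.cons_succ] at hi
    congr 1
    rw [Finset.sum_eq_single i]
    · rw [if_pos hi, ← hi]
      exact prod_pull ξ hξξ k f i
    · intro j _ hj
      rw [if_neg, smul_zero]
      intro hj2
      apply hj
      have := @hb.1 j.succ.succ i.succ.succ (by simp [hi, hj2])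
      simpa using this
    · simp
  rw [V2_def, Finset.sum_congr rfl (fun f _ => h2 f), h, smul_smul, fact_scale, V3_def]
  simp [Finset.mul_sum]

theorem xi_other (hξξ : ∀ a b, ξ a * ξ b = - (ξ b * ξ a)) (a b c e : Fin (k + 3))
    (ha : e ≠ a) (hb : e ≠ b) (hc : e ≠ c) : ξ e * Vthree ξ a b c = 0 := by
  rw [V3_def, mul_smul_comm, Finset.mul_sum, Finset.sum_eq_zero, smul_zero]
  intro f _
  by_cases h0 : eps (cat3 (n := k + 3) a b c f) = 0
  · rw [h0, zero_smul, mul_zero]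
  have hbij := eps_ne_zero h0
  rw [cat3_eq] at hbij
  obtain ⟨i, hi⟩ := hbij.2 e
  revert hi
  refine Fin.cases ?_ (fun i => ?_) i
  · intro hi; exact absurd hi.symm ha
  refine Fin.cases ?_ (fun i => ?_) i
  · intro hi; exact absurd hi.symm hb
  refine Fin.cases ?_ (fun i => ?_) i
  · intro hi; exact absurd hi.symm hc
  intro hi
  simp only [Fin.cons_succ] at hi
  clear hbij h0
  have key : ∀ (m : ℕ) (f : Fin m → Fin (k + 3)) (i : Fin m), f i = e →
      ξ e * (List.ofFn fun j => ξ (f j)).prod = 0 := by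
    intro m f i hi
    cases m with
    | zero => exact i.elim0
    | succ m =>
      rw [prod_pull ξ hξξ m f i, hi, mul_smul_comm, ← mul_assoc, zero_of_eq_neg (hξξ e e),
        zero_mul, smul_zero]
  rw [mul_smul_comm, key k f i hi, smul_zero]

theorem xi_V3 (hξξ : ∀ a b, ξ a * ξ b = - (ξ b * ξ a)) (a b c e : Fin (k + 3)) :
    ξ e * Vthree ξ a b c = (if e = a then Vtwo ξ b c else 0)
      + (if e = b then Vtwo ξ c a else 0) + (if e = c then Vtwo ξ a b else 0) := by
  by_cases hab : a = b
  · subst hab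
    rw [V3_diag, V2_diag, V2_swap ξ a c]
    split_ifs <;> simp
  by_cases hbc : b = c
  · subst hbc
    rw [V3_cyc, V3_cyc, V3_diag, V2_diag, V2_swap ξ a b]
    split_ifs <;> simp
  by_cases hca : c = a
  · subst hca
    rw [V3_cyc, V3_diag, V2_diag, V2_swap ξ b c]
    split_ifs <;> simp
  by_cases h1 : e = a
  · subst h1
    rw [← V3_cyc, xi_same ξ hξξ b c e hab (Ne.symm hca)]
    simp [hab, Ne.symm hca]
  by_cases h2 : e = b
  · subst h2
    rw [V3_cyc, xi_same ξ hξξ c a e hbc h1]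
    simp [h1, hbc]
  by_cases h3 : e = c
  · subst h3
    rw [xi_same ξ hξξ a b e h1 h2]
    simp [h1, h2]
  rw [xi_other ξ hξξ a b c e h1 h2 h3]
  simp [h1, h2, h3]

end vs

section parts

variable {k : ℕ} {A : Type*} [Ring A] [Algebra ℝ A] (ξ : Fin (k + 3) → A)

/-- the `dξ` part: relabelling by cyclicity of `𝒱_{abc}`. -/
theorem partA (Dξ : Fin (k + 3) → A) (M : Fin (k + 3) → Fin (k + 3) → A) :
    ∑ a, ∑ b, ∑ c, Vthree ξ a b c * (Dξ a * M b c)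
      = ∑ a, ∑ b, (∑ c, Vthree ξ a b c * Dξ c) * M a b := by
  rw [Finset.sum_comm]
  refine Finset.sum_congr rfl fun b _ => ?_
  rw [Finset.sum_comm]
  refine Finset.sum_congr rfl fun c _ => ?_
  rw [Finset.sum_mul]
  refine Finset.sum_congr rfl fun a _ => ?_
  rw [← V3_cyc, mul_assoc]

/-- the common value of the `dρ` parts, up to the factor `-2 (-1)^k`. -/
noncomputable def TT (η : Fin (k + 3) → Fin (k + 3) → ℝ) (ρ Dρ : Fin (k + 3) → Fin (k + 3) → A) :
    A := ∑ a, ∑ b, ∑ c, ∑ e, η e c • (Vtwo ξ a b * (ρ a e * Dρ b c))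

theorem partR1 (η : Fin (k + 3) → Fin (k + 3) → ℝ) (hη : ∀ a b, η a b = η b a)
    (ρ Dρ : Fin (k + 3) → Fin (k + 3) → A)
    (hρa : ∀ a b, ρ a b = - ρ b a)
    (hDρa : ∀ a b, Dρ a b = - Dρ b a)
    (hξξ : ∀ a b, ξ a * ξ b = - (ξ b * ξ a))
    (hξρ : ∀ a b c, ξ a * ρ b c = - (ρ b c * ξ a))
    (qξ : Fin (k + 3) → A)
    (hqξ : ∀ a, qξ a = ∑ b, ∑ c, η c b • (ρ a c * ξ b)) :
    ∑ a, ∑ b, ∑ c, Vthree ξ a b c * (qξ a * Dρ b c)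
      = -((-1 : ℝ) ^ k • ((2 : ℝ) • TT ξ η ρ Dρ)) := by
  have h1 : ∀ a b c, Vthree ξ a b c * (qξ a * Dρ b c)
      = -((-1 : ℝ) ^ k • ∑ f, ∑ e, η e f • ((ξ f * Vthree ξ a b c) * (ρ a e * Dρ b c))) := by
    intro a b c
    rw [hqξ]
    simp only [Finset.sum_mul, Finset.mul_sum, Finset.smul_sum, ← Finset.sum_neg_distrib]
    refine Finset.sum_congr rfl fun f _ => Finset.sum_congr rfl fun e _ => ?_
    have h2 : Vthree ξ a b c * (ρ a e * ξ f) = -((-1 : ℝ) ^ k • (ξ f * Vthree ξ a b c * ρ a e)) := by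
      rw [← smul_mul_assoc, ← V3_anti ξ (ξ f) (fun x => hξξ x f), mul_assoc, hξρ, mul_neg, neg_neg]
    rw [smul_mul_assoc, mul_smul_comm, ← mul_assoc, h2, neg_mul, smul_neg, smul_mul_assoc,
      smul_comm, mul_assoc]
  have t1 : ∑ a, ∑ b, ∑ c, ∑ e, η e a • (Vtwo ξ b c * (ρ a e * Dρ b c)) = 0 := by
    have : ∀ b c, ∑ a, ∑ e, η e a • (Vtwo ξ b c * (ρ a e * Dρ b c)) = 0 := by
      intro b c
      apply zero_of_eq_neg
      conv_lhs => rw [Finset.sum_comm]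
      simp only [← Finset.sum_neg_distrib]
      refine Finset.sum_congr rfl fun e _ => Finset.sum_congr rfl fun a _ => ?_
      rw [hη, hρa a e]
      simp
    rw [Finset.sum_comm]
    refine Finset.sum_eq_zero fun b _ => ?_
    rw [Finset.sum_comm]
    exact Finset.sum_eq_zero fun c _ => this b c
  have t2 : ∑ a, ∑ b, ∑ c, ∑ e, η e b • (Vtwo ξ c a * (ρ a e * Dρ b c)) = TT ξ η ρ Dρ := by
    unfold TT
    refine Finset.sum_congr rfl fun a _ => ?_
    rw [Finset.sum_comm]
    refine Finset.sum_congr rfl fun b _ => Finset.sum_congr rfl fun c _ =>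
      Finset.sum_congr rfl fun e _ => ?_
    rw [V2_swap ξ b a, hDρa c b]
    simp
  simp only [h1, Finset.sum_neg_distrib, ← Finset.smul_sum, xi_V3 ξ hξξ]
  refine congrArg (fun x => -((-1 : ℝ) ^ k • x)) ?_
  have h3 : ∀ a b c, ∑ f, ∑ e, η e f • (((if f = a then Vtwo ξ b c else 0)
      + (if f = b then Vtwo ξ c a else 0) + (if f = c then Vtwo ξ a b else 0))
        * (ρ a e * Dρ b c))
      = ∑ e, η e a • (Vtwo ξ b c * (ρ a e * Dρ b c))
        + ∑ e, η e b • (Vtwo ξ c a * (ρ a e * Dρ b c))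
        + ∑ e, η e c • (Vtwo ξ a b * (ρ a e * Dρ b c)) := by
    intro a b c
    rw [Finset.sum_comm]
    simp only [add_mul, ite_mul, zero_mul, smul_add, smul_ite, smul_zero,
      Finset.sum_add_distrib, Finset.sum_ite_eq', Finset.mem_univ, if_true]
  simp only [h3, Finset.sum_add_distrib]
  rw [t1, t2, zero_add, two_smul]
  rfl

theorem partR2 (η : Fin (k + 3) → Fin (k + 3) → ℝ) (hη : ∀ a b, η a b = η b a)
    (ρ Dρ : Fin (k + 3) → Fin (k + 3) → A)
    (hρa : ∀ a b, ρ a b = - ρ b a)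
    (hDρa : ∀ a b, Dρ a b = - Dρ b a)
    (hDρc : ∀ a b x, Dρ a b * x = x * Dρ a b)
    (d : A →ₗ[ℝ] A)
    (hdρ : ∀ a b, d (ρ a b) = Dρ a b)
    (hdLρ : ∀ a b x, d (ρ a b * x) = Dρ a b * x - ρ a b * d x) :
    ∑ a, ∑ b, Vtwo ξ a b * d (∑ c, ∑ e, η c e • (ρ a c * ρ e b))
      = (2 : ℝ) • TT ξ η ρ Dρ := by
  simp only [map_sum, map_smul, hdLρ, hdρ, Finset.mul_sum, mul_smul_comm, mul_sub, smul_sub,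
    Finset.sum_sub_distrib]
  rw [two_smul, sub_eq_add_neg]
  refine congrArg₂ (· + ·) ?_ ?_
  · unfold TT
    rw [Finset.sum_comm]
    refine Finset.sum_congr rfl fun a _ => Finset.sum_congr rfl fun b _ =>
      Finset.sum_congr rfl fun c _ => Finset.sum_congr rfl fun e _ => ?_
    rw [V2_swap ξ b a, hη c e, hρa e a, hDρc]
    simp
  · unfold TT
    simp only [← Finset.sum_neg_distrib]
    refine Finset.sum_congr rfl fun a _ => Finset.sum_congr rfl fun b _ => ?_
    rw [Finset.sum_comm]
    refine Finset.sum_congr rfl fun c _ => Finset.sum_congr rfl fun e _ => ?_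
    rw [hDρa c b]
    simp

/-- the common value of the `λ` parts. -/
noncomputable def WW (Dξ : Fin (k + 3) → A) : A := ∑ a, ∑ b, Vtwo ξ a b * (ξ b * Dξ a)

theorem partW1 (hξξ : ∀ a b, ξ a * ξ b = - (ξ b * ξ a))
    (Dξ : Fin (k + 3) → A) (hDξc : ∀ a x, Dξ a * x = x * Dξ a) :
    ∑ a, ∑ b, ∑ c, Vthree ξ a b c * (Dξ a * (ξ b * ξ c))
      = -((-1 : ℝ) ^ k • (((k : ℝ) + 1) • WW ξ Dξ)) := by
  have h1 : ∀ a b c, Vthree ξ a b c * (Dξ a * (ξ b * ξ c))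
      = -((-1 : ℝ) ^ k • ((ξ c * Vthree ξ a b c) * (ξ b * Dξ a))) := by
    intro a b c
    rw [hDξc, hξξ b c, ← smul_mul_assoc, ← V3_anti ξ (ξ c) (fun x => hξξ x c)]
    simp [mul_assoc]
  have h2 : ∀ a b, ∑ c, ξ c * Vthree ξ a b c = ((k : ℝ) + 1) • Vtwo ξ a b := by
    intro a b
    simp only [xi_V3 ξ hξξ, Finset.sum_add_distrib, Finset.sum_ite_eq', Finset.mem_univ, if_true,
      Finset.sum_const, Finset.card_univ, Fintype.card_fin]
    rw [V2_swap ξ b a, ← Nat.cast_smul_eq_nsmul ℝ]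
    push_cast
    module
  simp only [h1, Finset.sum_neg_distrib, ← Finset.smul_sum, ← Finset.sum_mul, h2]
  congr 2
  simp only [smul_mul_assoc, ← Finset.smul_sum]
  rfl

theorem partW2 (Dξ : Fin (k + 3) → A) (hDξc : ∀ a x, Dξ a * x = x * Dξ a)
    (d : A →ₗ[ℝ] A) (hdξ : ∀ a, d (ξ a) = Dξ a)
    (hdLξ : ∀ a x, d (ξ a * x) = Dξ a * x - ξ a * d x) :
    ∑ a, ∑ b, Vtwo ξ a b * d (ξ a * ξ b) = (2 : ℝ) • WW ξ Dξ := by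
  simp only [hdLξ, hdξ, mul_sub, Finset.sum_sub_distrib]
  rw [two_smul, sub_eq_add_neg]
  unfold WW
  congr 1
  · simp only [hDξc]
  · rw [Finset.sum_comm]
    simp only [← Finset.sum_neg_distrib]
    refine Finset.sum_congr rfl fun a _ => Finset.sum_congr rfl fun b _ => ?_
    rw [V2_swap ξ b a]
    simp

end parts

/-- for the Chevalley-Eilenberg vector field `q` with components
`q ξ^a = ρ^a{}_b ξ^b`, `q ρ^{ab} = ρ^a{}_c ρ^{cb} + λ ξ^a ξ^b` and the 2-form
`ω = 𝒱_{abc}(ξ) dξ^a ∧ dρ^{bc}`, the contraction satisfies `ι_q ω = d𝓗` with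
`𝓗 = 𝒱_{ab}(ξ)(ρ^a{}_c ρ^{cb} + ((n-2)λ/n) ξ^a ξ^b)`.  The de Rham complex of
`g[1]` is modelled as in Statement 2; `ι` is the (even) contraction with `q`. -/
theorem contraction_of_q_is_dH
    (n : ℕ) (hn : 3 ≤ n) (lam : ℝ) (A : Type*) [Ring A] [Algebra ℝ A]
    (η : Fin n → Fin n → ℝ) (hη : ∀ a b, η a b = η b a)
    (ξ : Fin n → A) (ρ : Fin n → Fin n → A)
    (Dξ : Fin n → A) (Dρ : Fin n → Fin n → A)
    (hρa : ∀ a b, ρ a b = - ρ b a)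
    (hDρa : ∀ a b, Dρ a b = - Dρ b a)
    (hξξ : ∀ a b, ξ a * ξ b = - (ξ b * ξ a))
    (hξρ : ∀ a b c, ξ a * ρ b c = - (ρ b c * ξ a))
    (hρρ : ∀ a b c d, ρ a b * ρ c d = - (ρ c d * ρ a b))
    (hDξc : ∀ a x, Dξ a * x = x * Dξ a)
    (hDρc : ∀ a b x, Dρ a b * x = x * Dρ a b)
    -- the de Rham differential
    (d : A →ₗ[ℝ] A)
    (hdξ : ∀ a, d (ξ a) = Dξ a)
    (hdρ : ∀ a b, d (ρ a b) = Dρ a b)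
    (hdDξ : ∀ a, d (Dξ a) = 0)
    (hdDρ : ∀ a b, d (Dρ a b) = 0)
    (hdLξ : ∀ a x, d (ξ a * x) = Dξ a * x - ξ a * d x)
    (hdLρ : ∀ a b x, d (ρ a b * x) = Dρ a b * x - ρ a b * d x)
    (hdLDξ : ∀ a x, d (Dξ a * x) = Dξ a * d x)
    (hdLDρ : ∀ a b x, d (Dρ a b * x) = Dρ a b * d x)
    -- the components of the CE vector field `q`
    (qξ : Fin n → A) (qρ : Fin n → Fin n → A)
    (hqξ : ∀ a, qξ a = ∑ b, ∑ c, η c b • (ρ a c * ξ b))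
    (hqρ : ∀ a b, qρ a b =
      (∑ c, ∑ d, η c d • (ρ a c * ρ d b)) + lam • (ξ a * ξ b))
    -- the contraction `ι_q`: an even derivation killing the coordinates and
    -- replacing differentials by the components of `q`
    (ι : A →ₗ[ℝ] A)
    (hιξ : ∀ a, ι (ξ a) = 0)
    (hιρ : ∀ a b, ι (ρ a b) = 0)
    (hιDξ : ∀ a, ι (Dξ a) = qξ a)
    (hιDρ : ∀ a b, ι (Dρ a b) = qρ a b)
    (hιLξ : ∀ a x, ι (ξ a * x) = ξ a * ι x)
    (hιLρ : ∀ a b x, ι (ρ a b * x) = ρ a b * ι x)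
    (hιLDξ : ∀ a x, ι (Dξ a * x) = qξ a * x + Dξ a * ι x)
    (hιLDρ : ∀ a b x, ι (Dρ a b * x) = qρ a b * x + Dρ a b * ι x) :
    ι (∑ a, ∑ b, ∑ c, Vthree ξ a b c * (Dξ a * Dρ b c))
      = d (∑ a, ∑ b, Vtwo ξ a b *
            ((∑ c, ∑ e, η c e • (ρ a c * ρ e b))
              + (((n : ℝ) - 2) * lam / (n : ℝ)) • (ξ a * ξ b))) := by
  obtain ⟨k, rfl⟩ : ∃ k, n = k + 3 := ⟨n - 3, by omega⟩
  have hL : ι (∑ a, ∑ b, ∑ c, Vthree ξ a b c * (Dξ a * Dρ b c))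
      = ∑ a, ∑ b, ∑ c, Vthree ξ a b c * (qξ a * Dρ b c)
        + ∑ a, ∑ b, ∑ c, Vthree ξ a b c * (Dξ a * (∑ f, ∑ e, η f e • (ρ b f * ρ e c)))
        + lam • ∑ a, ∑ b, ∑ c, Vthree ξ a b c * (Dξ a * (ξ b * ξ c)) := by
    simp only [map_sum, V3_iota ξ ι hιLξ, hιLDξ, hιDρ, hqρ, mul_add, Finset.sum_add_distrib,
      Finset.smul_sum, mul_smul_comm, add_assoc]
  rw [hL]
  simp only [map_sum, V2_d ξ Dξ hDξc d hdLξ, Finset.sum_add_distrib]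
  simp only [map_add, map_smul, mul_add, smul_add, mul_smul_comm, Finset.sum_add_distrib,
    ← Finset.smul_sum]
  rw [partR1 ξ η hη ρ Dρ hρa hDρa hξξ hξρ qξ hqξ,
    partR2 ξ η hη ρ Dρ hρa hDρa hDρc d hdρ hdLρ,
    partW2 ξ Dξ hDξc d hdξ hdLξ, ← partA ξ Dξ (fun a b => ξ a * ξ b),
    ← partA ξ Dξ (fun b c => ∑ f, ∑ e, η f e • (ρ b f * ρ e c)),
    partW1 ξ hξξ Dξ hDξc]
  have hk : (k : ℝ) + 3 ≠ 0 := by positivity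
  have hkap : ((((k + 3 : ℕ) : ℝ) - 2) * lam / ((k + 3 : ℕ) : ℝ)) * ((k : ℝ) + 3)
      = lam * ((k : ℝ) + 1) := by
    push_cast
    field_simp
    ring
  generalize ((((k + 3 : ℕ) : ℝ) - 2) * lam / ((k + 3 : ℕ) : ℝ)) = κ at hkap ⊢
  rw [pow_succ]
  generalize (-1 : ℝ) ^ k = s
  generalize (∑ a, ∑ b, ∑ c, Vthree ξ a b c * (Dξ a * (∑ f, ∑ e, η f e • (ρ b f * ρ e c)))) = X
  have e1 : lam • -(s • ((k : ℝ) + 1) • WW ξ Dξ) = -(s • ((lam * ((k : ℝ) + 1)) • WW ξ Dξ)) := by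
    module
  rw [e1, ← hkap]
  module
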